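/- For all λ ≥ 1, ε ≥ 0 and κ ≥ 0 there exist constants λ' ≥ 1 and ε' ≥ 0, depending only on λ, ε and κ, with the following property: if φ, φ' : ℍ ×₂ ℝ → ℍ ×₂ ℝ are (λ,ε)-quasi-isometric embeddings satisfying dist(φ'(φ(x)), x) ≤ κ and dist(φ(φ'(x)), x) ≤ κ for all x, then the map from ℍ to ℍ sending x to the ℍ-coordinate of φ(x, 0) is a (λ',ε')-quasi-isometric embedding of the hyperbolic plane into itself. -/

import Mathlib

open UpperHalfPlane

/-- `ℍ ×₂ ℝ`: the product of the hyperbolic plane and the real line with the ℓ² metric. -/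
abbrev H2R := WithLp 2 (UpperHalfPlane × ℝ)

/-- The horizontal (ℍ-) coordinate of a point of `ℍ ×₂ ℝ`. -/
noncomputable def horiz (p : H2R) : UpperHalfPlane := (WithLp.equiv 2 (UpperHalfPlane × ℝ) p).1

/-- The point of `ℍ ×₂ ℝ` with horizontal coordinate `z` and vertical coordinate `t`. -/
noncomputable def mk2 (z : UpperHalfPlane) (t : ℝ) : H2R :=
  (WithLp.equiv 2 (UpperHalfPlane × ℝ)).symm (z, t)

/-- A `(λ,ε)`-quasi-isometric embedding between metric spaces. -/
def IsQIE {X Y : Type*} [PseudoMetricSpace X] [PseudoMetricSpace Y]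
    (lam eps : ℝ) (f : X → Y) : Prop :=
  ∀ x y, (1 / lam) * dist x y - eps ≤ dist (f x) (f y) ∧
    dist (f x) (f y) ≤ lam * dist x y + eps

noncomputable def vert (p : H2R) : ℝ := p.snd

theorem H2R_dist (p q : H2R) :
    dist p q = Real.sqrt (dist (horiz p) (horiz q) ^ 2 + (vert p - vert q) ^ 2) := by
  rw [WithLp.prod_dist_eq_add (by norm_num), Real.sqrt_eq_rpow]
  simp [horiz, vert, Real.dist_eq]

theorem horiz_le (p q : H2R) : dist (horiz p) (horiz q) ≤ dist p q := by
  rw [H2R_dist]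
  apply Real.le_sqrt_of_sq_le
  nlinarith [sq_nonneg (vert p - vert q)]

theorem vert_le (p q : H2R) : |vert p - vert q| ≤ dist p q := by
  rw [H2R_dist]
  apply Real.le_sqrt_of_sq_le
  rw [sq_abs]
  nlinarith [sq_nonneg (dist (horiz p) (horiz q))]

theorem H2R_dist_le (p q : H2R) : dist p q ≤ dist (horiz p) (horiz q) + |vert p - vert q| := by
  rw [H2R_dist]
  apply Real.sqrt_le_iff.2
  constructor
  · positivity
  · have h1 : 0 ≤ dist (horiz p) (horiz q) := dist_nonneg
    have h2 := abs_nonneg (vert p - vert q)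
    rw [← sq_abs (vert p - vert q)]
    nlinarith [mul_nonneg h1 h2]

@[simp] theorem horiz_mk2 (z : UpperHalfPlane) (t : ℝ) : horiz (mk2 z t) = z := rfl
@[simp] theorem vert_mk2 (z : UpperHalfPlane) (t : ℝ) : vert (mk2 z t) = t := rfl
theorem mk2_eta (p : H2R) : mk2 (horiz p) (vert p) = p := rfl

/-- Existence of midpoints in the hyperbolic plane. -/
theorem exists_midpoint (a b : UpperHalfPlane) :
    ∃ m : UpperHalfPlane, dist a m = dist a b / 2 ∧ dist b m = dist a b / 2 := by
  have ha := a.im_pos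
  have hb := b.im_pos
  set Q : ℝ := (a.re - b.re) ^ 2 + (a.im + b.im) ^ 2 with hQ
  have hQpos : 0 < Q := by positivity
  set w : ℝ := Real.sqrt (a.im * b.im * Q) with hw
  have hwpos : 0 < w := Real.sqrt_pos.2 (by positivity)
  have hw2 : w ^ 2 = a.im * b.im * Q := Real.sq_sqrt (by positivity)
  have hs : 0 < a.im + b.im := by positivity
  let m : UpperHalfPlane :=
    ⟨⟨(a.re * b.im + b.re * a.im) / (a.im + b.im), w / (a.im + b.im)⟩, by
      show 0 < w / (a.im + b.im)
      positivity⟩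
  have hmre : m.re = (a.re * b.im + b.re * a.im) / (a.im + b.im) := rfl
  have hmim : m.im = w / (a.im + b.im) := rfl
  have hD : Real.cosh (dist a b / 2) ^ 2 = Q / (4 * (a.im * b.im)) := by
    have h1 := Real.cosh_sq (dist a b / 2)
    have h2 := Real.cosh_two_mul (dist a b / 2)
    rw [show 2 * (dist a b / 2) = dist a b by ring, UpperHalfPlane.cosh_dist'] at h2
    have : Real.cosh (dist a b / 2) ^ 2 =
      (((a.re - b.re) ^ 2 + a.im ^ 2 + b.im ^ 2) / (2 * a.im * b.im) + 1) / 2 := by linarith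
    rw [this, hQ]; field_simp; ring
  have hD' : Real.cosh (dist a b / 2) = w / (2 * (a.im * b.im)) := by
    have hc := Real.cosh_pos (dist a b / 2)
    have : Real.cosh (dist a b / 2) ^ 2 = (w / (2 * (a.im * b.im))) ^ 2 := by
      rw [hD, div_pow, hw2]; field_simp; ring
    exact (pow_left_inj₀ hc.le (by positivity) (by norm_num)).1 this
  have key : ∀ u v : ℝ, 0 ≤ u → 0 ≤ v → Real.cosh u = Real.cosh v → u = v := by
    intro u v hu hv h
    have := Real.cosh_strictMonoOn.injOn hu hv h
    exact this
  have hn : (0:ℝ) ≤ dist a b / 2 := by positivity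
  refine ⟨m, key _ _ dist_nonneg hn ?_, key _ _ dist_nonneg hn ?_⟩
  · rw [UpperHalfPlane.cosh_dist', hD', hmre, hmim]
    field_simp
    rw [hw2, hQ]
    ring
  · rw [UpperHalfPlane.cosh_dist', hD', hmre, hmim]
    field_simp
    rw [hw2, hQ]
    ring

noncomputable def rho (m x y : UpperHalfPlane) : ℝ :=
  2 * m.im * dist (1 / ((x : ℂ) - m)) (1 / ((y : ℂ) - m))

theorem rho_triangle (m x y z : UpperHalfPlane) : rho m x z ≤ rho m x y + rho m y z := by
  unfold rho
  rw [← mul_add]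
  have := m.im_pos
  exact mul_le_mul_of_nonneg_left (dist_triangle _ _ _) (by positivity)

theorem rho_eq (m x y : UpperHalfPlane) (hx : x ≠ m) (hy : y ≠ m) :
    rho m x y = Real.sinh (dist x y / 2) /
      (Real.sinh (dist x m / 2) * Real.sinh (dist y m / 2)) := by
  have hx' : (x : ℂ) - m ≠ 0 := by
    rw [sub_ne_zero]; exact fun h => hx (UpperHalfPlane.ext h)
  have hy' : (y : ℂ) - m ≠ 0 := by
    rw [sub_ne_zero]; exact fun h => hy (UpperHalfPlane.ext h)
  have e : 1 / ((x : ℂ) - m) - 1 / ((y : ℂ) - m) = (y - x) / ((x - m) * (y - m)) := by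
    field_simp; ring
  unfold rho
  rw [UpperHalfPlane.sinh_half_dist, UpperHalfPlane.sinh_half_dist,
    UpperHalfPlane.sinh_half_dist, dist_eq_norm (1 / ((x : ℂ) - m)), e, norm_div, norm_mul,
    dist_eq_norm, dist_eq_norm, dist_eq_norm, norm_sub_rev (y : ℂ) x]
  have h1 : 0 < ‖(x : ℂ) - m‖ := norm_pos_iff.2 hx'
  have h2 : 0 < ‖(y : ℂ) - m‖ := norm_pos_iff.2 hy'
  have px := x.im_pos
  have py := y.im_pos
  have pm := m.im_pos
  rw [Real.sqrt_mul px.le, Real.sqrt_mul px.le, Real.sqrt_mul py.le]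
  have qx := Real.sqrt_pos.2 px
  have qy := Real.sqrt_pos.2 py
  have qm := Real.sqrt_pos.2 pm
  have : m.im = Real.sqrt m.im ^ 2 := (Real.sq_sqrt pm.le).symm
  rw [this, Real.sqrt_sq qm.le]
  field_simp

theorem rho_path (m : UpperHalfPlane) (h : ℕ → UpperHalfPlane) (N : ℕ) (J R : ℝ)
    (hR : 0 < R) (hJ : ∀ i < N, dist (h i) (h (i + 1)) ≤ J)
    (hfar : ∀ i ≤ N, R ≤ dist (h i) m) :
    rho m (h 0) (h N) ≤ N * (Real.sinh (J / 2) / Real.sinh (R / 2) ^ 2) := by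
  have hsR : 0 < Real.sinh (R / 2) := Real.sinh_pos_iff.2 (by positivity)
  have hne : ∀ i ≤ N, h i ≠ m := by
    intro i hi he
    have := hfar i hi
    rw [he, dist_self] at this
    linarith
  have : ∀ k ≤ N, rho m (h 0) (h k) ≤ k * (Real.sinh (J / 2) / Real.sinh (R / 2) ^ 2) := by
    intro k
    induction k with
    | zero => intro _; simp [rho]
    | succ k ih =>
      intro hk
      have h1 := ih (by omega)
      have h2 := rho_triangle m (h 0) (h k) (h (k + 1))
      have h3 : rho m (h k) (h (k + 1)) ≤ Real.sinh (J / 2) / Real.sinh (R / 2) ^ 2 := by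
        rw [rho_eq m _ _ (hne k (by omega)) (hne (k + 1) hk), sq]
        have a1 : Real.sinh (dist (h k) (h (k + 1)) / 2) ≤ Real.sinh (J / 2) :=
          Real.sinh_le_sinh.2 (by linarith [hJ k (by omega)])
        have a2 : Real.sinh (R / 2) ≤ Real.sinh (dist (h k) m / 2) :=
          Real.sinh_le_sinh.2 (by linarith [hfar k (by omega)])
        have a3 : Real.sinh (R / 2) ≤ Real.sinh (dist (h (k + 1)) m / 2) :=
          Real.sinh_le_sinh.2 (by linarith [hfar (k + 1) hk])
        have a0 : 0 ≤ Real.sinh (dist (h k) (h (k + 1)) / 2) :=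
          Real.sinh_nonneg_iff.2 (by positivity)
        have a4 := mul_le_mul a2 a3 hsR.le (hsR.le.trans a2)
        exact div_le_div₀ (a0.trans a1) a1 (by positivity) a4
      push_cast
      linarith
  exact this N le_rfl

theorem rho_near (m a a' : UpperHalfPlane) (D : ℝ) (hD : 8 ≤ D) (ha : dist a m = D / 2)
    (haa : dist a a' ≤ D / 8) : rho m a a' ≤ 1 / 2 := by
  have h3 : 3 * D / 8 ≤ dist a' m := by
    have := dist_triangle a a' m
    linarith
  have n1 : a ≠ m := by
    rintro rfl; rw [dist_self] at ha; linarith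
  have n2 : a' ≠ m := by
    rintro rfl; rw [dist_self] at h3; linarith
  rw [rho_eq m _ _ n1 n2, ha]
  have a1 : 2 ≤ Real.sinh (D / 2 / 2) := by
    have := Real.self_le_sinh_iff.2 (show 0 ≤ D / 2 / 2 by linarith)
    linarith
  have a2 : Real.sinh (dist a a' / 2) ≤ Real.sinh (dist a' m / 2) :=
    Real.sinh_le_sinh.2 (by linarith)
  have a3 : 0 < Real.sinh (dist a' m / 2) := Real.sinh_pos_iff.2 (by linarith)
  rw [div_le_iff₀ (by positivity)]
  nlinarith

/-- A discrete path joining neighbourhoods of `a` and `b` passes near the midpoint. -/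
theorem path_near_midpoint (m a b : UpperHalfPlane) (D : ℝ) (hD : 8 ≤ D) (hab : dist a b = D)
    (ham : dist a m = D / 2) (hbm : dist b m = D / 2)
    (h : ℕ → UpperHalfPlane) (N : ℕ) (J R : ℝ) (hR : 0 < R)
    (hJ : ∀ i < N, dist (h i) (h (i + 1)) ≤ J)
    (h0 : dist a (h 0) ≤ D / 8) (hN : dist b (h N) ≤ D / 8)
    (hRN : N * Real.sinh (J / 2) < Real.sinh (R / 2) ^ 2) :
    ∃ i ≤ N, dist (h i) m < R := by
  by_contra! hcon
  have h1 := rho_path m h N J R hR hJ hcon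
  have h2 := rho_near m a (h 0) D hD ham h0
  have h3 := rho_near m b (h N) D hD hbm hN
  have h4 : 2 ≤ rho m a b := by
    have n1 : a ≠ m := by
      rintro rfl; rw [dist_self] at ham; linarith
    have n2 : b ≠ m := by
      rintro rfl; rw [dist_self] at hbm; linarith
    rw [rho_eq m _ _ n1 n2, ham, hbm, hab, show D / 2 = 2 * (D / 2 / 2) by ring,
      Real.sinh_two_mul, show 2 * (D / 2 / 2) / 2 = D / 2 / 2 by ring]
    have p : 0 < Real.sinh (D / 2 / 2) := Real.sinh_pos_iff.2 (by linarith)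
    rw [le_div_iff₀ (by positivity)]
    have := Real.sinh_lt_cosh (D / 2 / 2)
    nlinarith
  have h5 := rho_triangle m a (h 0) b
  have h6 := rho_triangle m (h 0) (h N) b
  have h7 : rho m (h N) b = rho m b (h N) := by unfold rho; rw [dist_comm]
  have hs : 0 < Real.sinh (R / 2) ^ 2 := by
    have := Real.sinh_pos_iff.2 (show 0 < R / 2 by linarith)
    positivity
  have h8 : N * (Real.sinh (J / 2) / Real.sinh (R / 2) ^ 2) < 1 := by
    rw [← mul_div_assoc, div_lt_one hs]; exact hRN
  linarith

/-- Many separated points in a small ball. -/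
theorem exists_separated (x : UpperHalfPlane) (T : ℝ) (hT : 0 ≤ T) :
    ∃ y : ℕ → UpperHalfPlane, (∀ k l, k ≠ l → T ≤ dist (y k) (y l)) ∧
      ∀ k, dist x (y k) ≤ 2 * Real.log (k + 1) + T := by
  have hx := x.im_pos
  set E := Real.exp (T / 2) with hE
  have hE1 : 1 ≤ E := Real.one_le_exp (by linarith)
  let y : ℕ → UpperHalfPlane := fun k => (k * E * x.im : ℝ) +ᵥ x
  have hd : ∀ k l, Real.sinh (dist (y k) (y l) / 2) = |(k : ℝ) - l| * E / 2 := by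
    intro k l
    rw [UpperHalfPlane.sinh_half_dist]
    have e : ((y k : UpperHalfPlane) : ℂ) - (y l : UpperHalfPlane) =
        ((((k : ℝ) - l) * E * x.im : ℝ) : ℂ) := by
      simp only [y, UpperHalfPlane.coe_vadd]
      push_cast; ring
    rw [dist_eq_norm, e, Complex.norm_real, Real.norm_eq_abs, abs_mul, abs_mul,
      abs_of_pos hx, abs_of_pos (by positivity : 0 < E)]
    have : ∀ k, (y k).im = x.im := fun k => UpperHalfPlane.vadd_im _ _
    rw [this, this, Real.sqrt_mul_self hx.le]
    field_simp
  refine ⟨y, ?_, ?_⟩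
  · intro k l hkl
    have h1 : (1 : ℝ) ≤ |(k : ℝ) - l| := by
      have : (1 : ℤ) ≤ |(k : ℤ) - l| := Int.one_le_abs (by omega)
      exact_mod_cast this
    have : Real.sinh (T / 2) ≤ Real.sinh (dist (y k) (y l) / 2) := by
      rw [hd, Real.sinh_eq]
      have := Real.exp_pos (-(T / 2))
      nlinarith
    have := Real.sinh_le_sinh.1 this
    linarith
  · intro k
    have h0 : y 0 = x := by simp [y]
    have hk := hd 0 k
    rw [h0] at hk
    have h1 : Real.sinh (dist x (y k) / 2) ≤ Real.sinh (Real.log (k + 1) + T / 2) := by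
      rw [hk, Real.sinh_eq, Real.exp_add, Real.exp_log (by positivity), ← hE]
      have : Real.exp (-(Real.log (k + 1) + T / 2)) ≤ 1 := by
        apply Real.exp_le_one_iff.2
        have := Real.log_nonneg (show (1:ℝ) ≤ k + 1 by linarith [Nat.cast_nonneg (α := ℝ) k])
        linarith
      simp only [Nat.cast_zero, zero_sub, abs_neg, Nat.abs_cast]
      nlinarith
    have := Real.sinh_le_sinh.1 h1
    linarith

theorem pigeon (u : ℕ → ℝ) (n : ℕ) (c B : ℝ)
    (hsep : ∀ k ≤ n, ∀ l ≤ n, k ≠ l → 1 ≤ |u k - u l|)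
    (hb : ∀ k ≤ n, |u k - c| ≤ B) : (n : ℝ) ≤ 2 * B := by
  have hB : 0 ≤ B := (abs_nonneg _).trans (hb 0 (Nat.zero_le _))
  have hm : ∀ k ∈ Finset.range (n + 1), ⌊u k - c + B⌋₊ ∈ Finset.range (⌊2 * B⌋₊ + 1) := by
    intro k hk
    rw [Finset.mem_range] at hk ⊢
    have := abs_le.1 (hb k (by omega))
    exact Nat.lt_succ_of_le (Nat.floor_le_floor (by linarith))
  have hi : Set.InjOn (fun k => ⌊u k - c + B⌋₊) (Finset.range (n + 1) : Set ℕ) := by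
    intro k hk l hl he
    simp only [Finset.coe_range, Set.mem_Iio] at hk hl
    by_contra hne
    have h1 := hsep k (by omega) l (by omega) hne
    have bk := abs_le.1 (hb k (by omega))
    have bl := abs_le.1 (hb l (by omega))
    have f1 := Nat.floor_le (show 0 ≤ u k - c + B by linarith)
    have f2 := Nat.floor_le (show 0 ≤ u l - c + B by linarith)
    have f3 := Nat.lt_floor_add_one (u k - c + B)
    have f4 := Nat.lt_floor_add_one (u l - c + B)
    simp only at he
    rw [he] at f1 f3
    have : |u k - u l| < 1 := abs_lt.2 ⟨by linarith, by linarith⟩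
    linarith
  have := Finset.card_le_card_of_injOn _ hm hi
  simp only [Finset.card_range] at this
  have h2 : n ≤ ⌊2 * B⌋₊ := by omega
  exact (Nat.cast_le.2 h2).trans (Nat.floor_le (by positivity))

theorem log_sublinear (A η : ℝ) (hA : 0 < A) (hη : 0 < η) :
    ∃ C, ∀ r : ℝ, 0 ≤ r → Real.log (A * (r + 1)) ≤ η * r + C := by
  refine ⟨Real.log (A / η) + η, fun r hr => ?_⟩
  have e : A * (r + 1) = (A / η) * (η * (r + 1)) := by field_simp
  rw [e, Real.log_mul (by positivity) (by positivity)]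
  have := Real.log_le_sub_one_of_pos (show 0 < η * (r + 1) by positivity)
  linarith

theorem exists_r0 (c1 c2 c3 A A' η : ℝ) (h1 : 0 < c1) (h3 : 0 < c3)
    (hA : 0 < A) (hA' : 0 < A') (hη : 0 < η) :
    ∃ r0, ∀ r, 0 ≤ r → r0 ≤ r →
      c1 * Real.log (A * (r + 1)) + c2 + c3 * Real.log (A' * (r + 1)) ≤ η * r := by
  obtain ⟨C, hC⟩ := log_sublinear A (η / (4 * c1)) hA (by positivity)
  obtain ⟨C', hC'⟩ := log_sublinear A' (η / (4 * c3)) hA' (by positivity)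
  refine ⟨2 * (c1 * C + c2 + c3 * C') / η, fun r hr hrr => ?_⟩
  rw [div_le_iff₀ hη] at hrr
  have a := mul_le_mul_of_nonneg_left (hC r hr) h1.le
  have b := mul_le_mul_of_nonneg_left (hC' r hr) h3.le
  have e1 : c1 * (η / (4 * c1) * r + C) = η * r / 4 + c1 * C := by field_simp
  have e2 : c3 * (η / (4 * c3) * r + C') = η * r / 4 + c3 * C' := by field_simp
  rw [e1] at a
  rw [e2] at b
  linarith

theorem nearly_vertical_large (lam eps del : ℝ) (hlam : 1 ≤ lam) (heps : 0 ≤ eps)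
    (hdel : 0 < del) :
    ∃ r0 : ℝ, 0 ≤ r0 ∧ ∀ φ : H2R → H2R, IsQIE lam eps φ → ∀ x s t, r0 ≤ |s - t| →
      dist (horiz (φ (mk2 x s))) (horiz (φ (mk2 x t))) ≤ del * |s - t| := by
  set J := lam + eps with hJdef
  set A := 4 * Real.sinh (J / 2) + 4 with hA
  set A2 := 4 * lam + 2 * eps + 3 with hA2
  have hsJ : 0 ≤ Real.sinh (J / 2) := Real.sinh_nonneg_iff.2 (by linarith)
  have hl0 : 0 < lam := by linarith
  obtain ⟨r1, hr1⟩ := exists_r0 2 (lam * (eps + 1)) (2 * lam) A2 A (min 1 (del / (16 * lam)))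
    (by norm_num) (by linarith) (by linarith) (by linarith) (lt_min one_pos (by positivity))
  refine ⟨max (max r1 1) (max (8 / del) (16 * eps / del)),
    le_max_of_le_left (le_max_of_le_right zero_le_one), ?_⟩
  intro φ hφ x s t hrr
  set r := |s - t| with hr
  have g1 : r1 ≤ r := ((le_max_left _ _).trans (le_max_left _ _)).trans hrr
  have g2 : 1 ≤ r := ((le_max_right _ _).trans (le_max_left _ _)).trans hrr
  have g3 : 8 ≤ r * del := by
    rw [← div_le_iff₀ hdel]
    exact ((le_max_left _ _).trans (le_max_right _ _)).trans hrr
  have g4 : 16 * eps ≤ r * del := by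
    rw [← div_le_iff₀ hdel]
    exact ((le_max_right _ _).trans (le_max_right _ _)).trans hrr
  by_contra! hcon
  have hφh : ∀ p q, dist (horiz (φ p)) (horiz (φ q)) ≤ lam * dist p q + eps :=
    fun p q => (horiz_le _ _).trans (hφ p q).2
  set a := horiz (φ (mk2 x s)) with ha
  set b := horiz (φ (mk2 x t)) with hb
  obtain ⟨m, ham, hbm⟩ := exists_midpoint a b
  set D := dist a b with hD
  set R := Real.log (A * (r + 1)) with hR
  have hAr : 4 ≤ A * (r + 1) := by nlinarith
  have hRpos : 0 < R := Real.log_pos (by linarith)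
  set T := lam * (eps + 2 * R + 1) with hT
  have hT0 : 0 ≤ T := by positivity
  obtain ⟨y, hysep, hyx⟩ := exists_separated x T hT0
  set n := ⌈4 * lam * r + 2 * eps⌉₊ + 1 with hn
  have hn1 : 4 * lam * r + 2 * eps < n := by
    have := Nat.le_ceil (4 * lam * r + 2 * eps)
    rw [hn]; push_cast; linarith
  have hn2 : (n : ℝ) + 1 ≤ A2 * (r + 1) := by
    have := Nat.ceil_lt_add_one (show 0 ≤ 4 * lam * r + 2 * eps by positivity)
    rw [hn, hA2]; push_cast
    nlinarith [mul_nonneg heps (show 0 ≤ r by linarith)]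
  have hy : ∀ k ≤ n, dist x (y k) ≤ min 1 (del / (16 * lam)) * r := by
    intro k hk
    have h1 := hyx k
    have h2 : Real.log ((k : ℝ) + 1) ≤ Real.log (A2 * (r + 1)) := by
      apply Real.log_le_log (by positivity)
      have : (k : ℝ) ≤ n := Nat.cast_le.2 hk
      linarith
    have h3 := hr1 r (by linarith) g1
    have h4 : T = lam * (eps + 1) + 2 * lam * R := by rw [hT]; ring
    linarith
  have hy1 : ∀ k ≤ n, dist x (y k) ≤ r := fun k hk => (hy k hk).trans <| by
    have := mul_le_mul_of_nonneg_right (min_le_left 1 (del / (16 * lam))) (show 0 ≤ r by linarith)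
    linarith
  have hy2 : ∀ k ≤ n, lam * dist x (y k) + eps ≤ D / 8 := fun k hk => by
    have h1 := mul_le_mul_of_nonneg_right (min_le_right 1 (del / (16 * lam)))
      (show 0 ≤ r by linarith)
    have h2 := mul_le_mul_of_nonneg_left ((hy k hk).trans h1) hl0.le
    have h3 : lam * (del / (16 * lam) * r) = del * r / 16 := by field_simp
    linarith
  -- the subdivision of the vertical segment
  set N := ⌈r⌉₊ with hN
  have hNr : r ≤ N := Nat.le_ceil r
  have hNr' : (N : ℝ) < r + 1 := Nat.ceil_lt_add_one (by linarith)
  have hNpos : (0 : ℝ) < N := by linarith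
  let σ : ℕ → ℝ := fun i => s + (i / N : ℝ) * (t - s)
  have hσ0 : σ 0 = s := by simp [σ]
  have hσN : σ N = t := by simp only [σ]; field_simp; ring
  have hσJ : ∀ i, |σ i - σ (i + 1)| ≤ 1 := by
    intro i
    have : σ i - σ (i + 1) = (s - t) / N := by simp only [σ]; push_cast; field_simp; ring
    rw [this, abs_div, abs_of_pos hNpos, div_le_one hNpos]
    exact hNr
  have hσs : ∀ i ≤ N, |σ i - s| ≤ r := by
    intro i hi
    have e : σ i - s = (i / N : ℝ) * (t - s) := by simp only [σ]; ring
    have hi1 : (i / N : ℝ) ≤ 1 := by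
      rw [div_le_one hNpos]; exact Nat.cast_le.2 hi
    have hi0 : (0:ℝ) ≤ (i / N : ℝ) := by positivity
    rw [e, abs_mul, abs_of_nonneg hi0, abs_sub_comm t s, ← hr]
    nlinarith
  have hRN : N * Real.sinh (J / 2) < Real.sinh (R / 2) ^ 2 := by
    have h1 := Real.cosh_two_mul (R / 2)
    have h2 := Real.cosh_sq (R / 2)
    rw [show 2 * (R / 2) = R by ring, Real.cosh_eq, hR, Real.exp_log (by linarith), ← hR] at h1
    have h3 := Real.exp_pos (-R)
    have h4 : N * Real.sinh (J / 2) ≤ (r + 1) * Real.sinh (J / 2) :=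
      mul_le_mul_of_nonneg_right hNr'.le hsJ
    have h5 : A * (r + 1) = 4 * ((r + 1) * Real.sinh (J / 2)) + 4 * (r + 1) := by rw [hA]; ring
    linarith
  have hD8 : 8 ≤ D := by linarith
  have hex : ∀ k, ∃ i, k ≤ n → i ≤ N ∧ dist (horiz (φ (mk2 (y k) (σ i)))) m < R := by
    intro k
    by_cases hk : k ≤ n
    · obtain ⟨i, hi, hi'⟩ := path_near_midpoint m a b D hD8 rfl ham hbm
        (fun i => horiz (φ (mk2 (y k) (σ i)))) N J R hRpos
        (by
          intro i _
          refine (hφh _ _).trans ?_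
          have h1 := H2R_dist_le (mk2 (y k) (σ i)) (mk2 (y k) (σ (i + 1)))
          simp only [horiz_mk2, vert_mk2, dist_self, zero_add] at h1
          have h2 := mul_le_mul_of_nonneg_left (h1.trans (hσJ i)) hl0.le
          linarith)
        (by
          simp only [hσ0]
          refine (hφh _ _).trans (le_trans ?_ (hy2 k hk))
          have h1 := H2R_dist_le (mk2 x s) (mk2 (y k) s)
          simp only [horiz_mk2, vert_mk2, sub_self, abs_zero, add_zero] at h1
          have h2 := mul_le_mul_of_nonneg_left h1 hl0.le
          linarith)
        (by
          simp only [hσN]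
          refine (hφh _ _).trans (le_trans ?_ (hy2 k hk))
          have h1 := H2R_dist_le (mk2 x t) (mk2 (y k) t)
          simp only [horiz_mk2, vert_mk2, sub_self, abs_zero, add_zero] at h1
          have h2 := mul_le_mul_of_nonneg_left h1 hl0.le
          linarith)
        hRN
      exact ⟨i, fun _ => ⟨hi, hi'⟩⟩
    · exact ⟨0, fun h => absurd h hk⟩
  choose ι hι using hex
  have hfin := pigeon (fun k => vert (φ (mk2 (y k) (σ (ι k))))) n (vert (φ (mk2 x s)))
    (2 * lam * r + eps)
    (by
      intro k hk l hl hkl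
      have h1 := (hφ (mk2 (y k) (σ (ι k))) (mk2 (y l) (σ (ι l)))).1
      have h2 := H2R_dist_le (φ (mk2 (y k) (σ (ι k)))) (φ (mk2 (y l) (σ (ι l))))
      have h3 := dist_triangle_right (horiz (φ (mk2 (y k) (σ (ι k)))))
        (horiz (φ (mk2 (y l) (σ (ι l))))) m
      have h4 := (hι k hk).2
      have h5 := (hι l hl).2
      have h6 := horiz_le (mk2 (y k) (σ (ι k))) (mk2 (y l) (σ (ι l)))
      simp only [horiz_mk2] at h6
      have h7 := (hysep k l hkl).trans h6
      have h8 := mul_le_mul_of_nonneg_left h7 (show 0 ≤ 1 / lam by positivity)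
      have h9 : 1 / lam * T = eps + 2 * R + 1 := by rw [hT]; field_simp
      linarith)
    (by
      intro k hk
      refine (vert_le _ _).trans ((hφ _ _).2.trans ?_)
      have h1 := H2R_dist_le (mk2 (y k) (σ (ι k))) (mk2 x s)
      simp only [horiz_mk2, vert_mk2] at h1
      have h2 := hσs (ι k) (hι k hk).1
      have h3 := hy1 k hk
      rw [dist_comm] at h3
      have h4 := mul_le_mul_of_nonneg_left (h1.trans (add_le_add h3 h2)) hl0.le
      linarith)
  linarith

theorem nearly_vertical (lam eps del : ℝ) (hlam : 1 ≤ lam) (heps : 0 ≤ eps)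
    (hdel : 0 < del) :
    ∃ C : ℝ, 0 ≤ C ∧ ∀ φ : H2R → H2R, IsQIE lam eps φ → ∀ x s t,
      dist (horiz (φ (mk2 x s))) (horiz (φ (mk2 x t))) ≤ del * |s - t| + C := by
  obtain ⟨r0, hr0, h⟩ := nearly_vertical_large lam eps del hlam heps hdel
  refine ⟨lam * r0 + eps, by positivity, fun φ hφ x s t => ?_⟩
  rcases le_total r0 |s - t| with h1 | h1
  · have := h φ hφ x s t h1
    have : 0 ≤ lam * r0 := by positivity
    linarith
  · have h2 := (horiz_le _ _).trans (hφ (mk2 x s) (mk2 x t)).2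
    have h3 := H2R_dist_le (mk2 x s) (mk2 x t)
    simp only [horiz_mk2, vert_mk2, dist_self, zero_add] at h3
    have h4 := mul_le_mul_of_nonneg_left (h3.trans h1) (show 0 ≤ lam by linarith)
    have : 0 ≤ del * |s - t| := by positivity
    linarith

/-- If `φ` is a quasi-isometry of `ℍ ×₂ ℝ` (with quasi-inverse `φ'`), then the induced
map on the horizontal hyperbolic plane, `x ↦ horiz (φ (x,0))`, is a quasi-isometric
embedding of `ℍ` into itself, with constants depending only on `λ`, `ε`, `κ`. -/
theorem projected_map_is_qie (lam eps kap : ℝ) (hlam : 1 ≤ lam) (heps : 0 ≤ eps)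
    (hkap : 0 ≤ kap) :
    ∃ lam' ≥ (1 : ℝ), ∃ eps' ≥ (0 : ℝ),
      ∀ φ φ' : H2R → H2R, IsQIE lam eps φ → IsQIE lam eps φ' →
        (∀ x : H2R, dist (φ' (φ x)) x ≤ kap) →
        (∀ x : H2R, dist (φ (φ' x)) x ≤ kap) →
        IsQIE lam' eps' (fun x : UpperHalfPlane => horiz (φ (mk2 x 0))) := by
  have hl0 : 0 < lam := by linarith
  obtain ⟨C, hC0, hC⟩ := nearly_vertical lam eps (1 / (2 * lam)) hlam heps (by positivity)
  refine ⟨2 * lam, by linarith, 4 * kap + 3 * eps + 2 * C, by positivity, ?_⟩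
  intro φ φ' hφ hφ' h1 _ x y
  have hd : dist (mk2 x 0) (mk2 y 0) = dist x y := by
    apply le_antisymm
    · have := H2R_dist_le (mk2 x 0) (mk2 y 0)
      simpa using this
    · exact horiz_le (mk2 x 0) (mk2 y 0)
  have hxy : 0 ≤ dist x y := dist_nonneg
  have hup := (hφ (mk2 x 0) (mk2 y 0)).2
  rw [hd] at hup
  simp only
  set p := φ (mk2 x 0) with hp
  set q := φ (mk2 y 0) with hq
  have hpq := horiz_le p q
  have hv := vert_le p q
  constructor
  · have e1 := (horiz_le _ _).trans (h1 (mk2 x 0))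
    have e2 := (horiz_le _ _).trans (h1 (mk2 y 0))
    rw [← hp, horiz_mk2, ← mk2_eta p] at e1
    rw [← hq, horiz_mk2, ← mk2_eta q] at e2
    have e3 := hC φ' hφ' (horiz p) (vert p) (vert q)
    have e4 := (horiz_le _ _).trans (hφ' (mk2 (horiz p) (vert q)) (mk2 (horiz q) (vert q))).2
    have e5 := H2R_dist_le (mk2 (horiz p) (vert q)) (mk2 (horiz q) (vert q))
    simp only [horiz_mk2, vert_mk2, sub_self, abs_zero, add_zero] at e5
    have e6 := mul_le_mul_of_nonneg_left e5 hl0.le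
    have e7 := mul_le_mul_of_nonneg_left (hv.trans hup) (show 0 ≤ 1 / (2 * lam) by positivity)
    have e8 : 1 / (2 * lam) * (lam * dist x y + eps) = dist x y / 2 + eps / (2 * lam) := by
      field_simp
    have e9 : eps / (2 * lam) ≤ eps / 2 :=
      div_le_div_of_nonneg_left heps (by norm_num) (by linarith)
    have t1 := dist_triangle_left x y (horiz (φ' (mk2 (horiz p) (vert p))))
    have t2 := dist_triangle (horiz (φ' (mk2 (horiz p) (vert p)))) 
      (horiz (φ' (mk2 (horiz q) (vert q)))) y
    have t3 := dist_triangle (horiz (φ' (mk2 (horiz p) (vert p)))) 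
      (horiz (φ' (mk2 (horiz p) (vert q)))) (horiz (φ' (mk2 (horiz q) (vert q))))
    have key : dist x y ≤ 2 * lam * dist (horiz p) (horiz q) + (4 * kap + 3 * eps + 2 * C) := by
      linarith
    have hE : 0 ≤ 4 * kap + 3 * eps + 2 * C := by positivity
    have k2 : 1 / (2 * lam) * dist x y ≤ dist (horiz p) (horiz q) +
        (4 * kap + 3 * eps + 2 * C) / (2 * lam) := by
      rw [one_div, inv_mul_le_iff₀ (by positivity), mul_add, mul_div_cancel₀ _ (by positivity)]
      exact key
    have k3 : (4 * kap + 3 * eps + 2 * C) / (2 * lam) ≤ 4 * kap + 3 * eps + 2 * C :=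
      div_le_self hE (by linarith)
    linarith
  · have : 0 ≤ lam * dist x y := by positivity
    linarith
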